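/- arXiv:1012.5350 — 3 statements merged into one kernel-verified Lean document; each statement's English description precedes it below -/
import Mathlib

section
/- Let S be a compact convex subset of a Euclidean space whose affine hull is 2-dimensional. If the group of bijective affine transformations of S acts transitively on the set of extreme points of S, then S is affinely isomorphic to either a vertex-transitive convex polygon or the 2-dimensional closed unit disk. -/
noncomputable section

/-- `S` is affinely isomorphic to `T`: there is a bijective affine map from `S` onto `T`. -/
def AffIso {E F : Type*} [NormedAddCommGroup E] [NormedSpace ℝ E]
    [NormedAddCommGroup F] [NormedSpace ℝ F] (S : Set E) (T : Set F) : Prop :=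
  ∃ f : E →ᵃ[ℝ] F, Set.InjOn f S ∧ f '' S = T

/-- The group of bijective affine transformations of `S` acts transitively on the set of
extreme points of `S`. -/
def AutTransitiveOnExtreme {E : Type*} [NormedAddCommGroup E] [NormedSpace ℝ E]
    (S : Set E) : Prop :=
  ∀ x ∈ Set.extremePoints ℝ S, ∀ y ∈ Set.extremePoints ℝ S,
    ∃ f : E ≃ᵃ[ℝ] E, f '' S = S ∧ f x = y

open Set Metric MeasureTheory

section Transfer

variable {E F : Type*} [NormedAddCommGroup E] [NormedSpace ℝ E]
  [NormedAddCommGroup F] [NormedSpace ℝ F]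

/-- A set spanning an affine subspace of the dimension of `F` has affine coordinates in `F`. -/
theorem exists_affineMap_leftInverse_range_eq_affineSpan [FiniteDimensional ℝ E]
    [FiniteDimensional ℝ F] {S : Set E} (hS : S.Nonempty)
    (hdim : Module.finrank ℝ (affineSpan ℝ S).direction = Module.finrank ℝ F) :
    ∃ (φ : E →ᵃ[ℝ] F) (ψ : F →ᵃ[ℝ] E), Function.LeftInverse φ ψ ∧
      range ψ = affineSpan ℝ S := by
  obtain ⟨p, hp⟩ := hS
  have hpS : p ∈ affineSpan ℝ S := subset_affineSpan ℝ S hp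
  let e : F ≃ₗ[ℝ] (affineSpan ℝ S).direction := LinearEquiv.ofFinrankEq _ _ hdim.symm
  let u : F →ₗ[ℝ] E := (affineSpan ℝ S).direction.subtype ∘ₗ e.toLinearMap
  have hu : LinearMap.ker u = ⊥ :=
    LinearMap.ker_eq_bot.2 (Subtype.val_injective.comp e.injective)
  obtain ⟨l, hl⟩ := u.exists_leftInverse_of_injective hu
  refine ⟨l.toAffineMap.comp (AffineMap.id ℝ E - AffineMap.const ℝ E p),
    u.toAffineMap + AffineMap.const ℝ F p, fun y ↦ ?_, ?_⟩
  · simpa using LinearMap.congr_fun hl y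
  · ext x
    constructor
    · rintro ⟨y, rfl⟩
      exact AffineSubspace.vadd_mem_of_mem_direction (e y).2 hpS
    · intro hx
      refine ⟨e.symm ⟨x - p, AffineSubspace.vsub_mem_direction hx hpS⟩, ?_⟩
      simp [u]

theorem image_extremePoints_of_injOn {S : Set E} (hS : Convex ℝ S) {φ : E →ᵃ[ℝ] F}
    (hφ : InjOn φ S) : φ '' extremePoints ℝ S = extremePoints ℝ (φ '' S) := by
  ext y
  constructor
  · rintro ⟨x, hx, rfl⟩
    refine mem_extremePoints_iff_left.2 ⟨mem_image_of_mem _ hx.1, ?_⟩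
    rintro _ ⟨a, ha, rfl⟩ _ ⟨b, hb, rfl⟩ hab
    rw [← image_openSegment] at hab
    obtain ⟨z, hz, hzx⟩ := hab
    have : z = x := hφ (hS.openSegment_subset ha hb hz) hx.1 hzx
    subst this
    rw [(mem_extremePoints_iff_left.1 hx).2 a ha b hb hz]
  · rintro hy
    obtain ⟨x, hx, rfl⟩ := hy.1
    refine ⟨x, mem_extremePoints_iff_left.2 ⟨hx, fun a ha b hb hab ↦ ?_⟩, rfl⟩
    refine hφ ha hx ((mem_extremePoints_iff_left.1 hy).2 _ (mem_image_of_mem _ ha) _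
      (mem_image_of_mem _ hb) ?_)
    rw [← image_openSegment]
    exact mem_image_of_mem _ hab

theorem AutTransitiveOnExtreme.image {S : Set E} (hS : Convex ℝ S)
    (h : AutTransitiveOnExtreme S) {φ : E →ᵃ[ℝ] F} {ψ : F →ᵃ[ℝ] E}
    (hφψ : Function.LeftInverse φ ψ) (hψ : range ψ = affineSpan ℝ S) :
    AutTransitiveOnExtreme (φ '' S) := by
  have hψφ : ∀ x ∈ affineSpan ℝ S, ψ (φ x) = x := by
    intro x hx
    rw [← SetLike.mem_coe, ← hψ] at hx
    obtain ⟨y, rfl⟩ := hx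
    rw [hφψ]
  have hsub := subset_affineSpan ℝ S
  have hinj : InjOn φ S := fun x hx y hy hxy ↦ by
    rw [← hψφ x (hsub hx), hxy, hψφ y (hsub hy)]
  have hpres : ∀ f : E ≃ᵃ[ℝ] E, f '' S = S → ∀ y, f (ψ y) ∈ affineSpan ℝ S := by
    intro f hf y
    have hy : ψ y ∈ affineSpan ℝ S := by
      rw [← SetLike.mem_coe, ← hψ]
      exact mem_range_self y
    have : (affineSpan ℝ S).map f.toAffineMap = affineSpan ℝ S := by
      rw [AffineSubspace.map_span]
      exact congrArg _ hf
    rw [← this]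
    exact AffineSubspace.mem_map_of_mem _ hy
  rw [AutTransitiveOnExtreme, ← image_extremePoints_of_injOn hS hinj]
  rintro _ ⟨x, hx, rfl⟩ _ ⟨y, hy, rfl⟩
  obtain ⟨f, hf, rfl⟩ := h x hx y hy
  have hf' : f.symm '' S = S := by
    conv_lhs => rw [← hf]
    simp [image_image]
  have hinv : ∀ g : E ≃ᵃ[ℝ] E, g '' S = S → Function.LeftInverse
      (φ.comp (g.symm.toAffineMap.comp ψ)) (φ.comp (g.toAffineMap.comp ψ)) := by
    intro g hg z
    simp [hψφ _ (hpres g hg z), hφψ z]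
  refine ⟨AffineEquiv.mk ⟨φ.comp (f.toAffineMap.comp ψ), φ.comp (f.symm.toAffineMap.comp ψ),
    hinv f hf, hinv f.symm hf'⟩ (LinearEquiv.ofBijective (φ.comp (f.toAffineMap.comp ψ)).linear
    ?_) ?_, ?_, ?_⟩
  · rw [AffineMap.linear_bijective_iff]
    exact ⟨(hinv f hf).injective, (hinv f.symm hf').surjective⟩
  · intro p v
    exact (φ.comp (f.toAffineMap.comp ψ)).map_vadd p v
  · rw [image_image]
    conv_rhs => rw [← hf, image_image]
    refine image_congr fun x hx ↦ ?_
    change φ (f (ψ (φ x))) = φ (f x)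
    rw [hψφ x (hsub hx)]
  · change φ (f (ψ (φ x))) = φ (f x)
    rw [hψφ x (hsub hx.1)]

theorem exists_affineMap_injOn_autTransitiveOnExtreme_image [FiniteDimensional ℝ E]
    [FiniteDimensional ℝ F] {S : Set E} (hne : S.Nonempty) (hS : Convex ℝ S)
    (hdim : Module.finrank ℝ (affineSpan ℝ S).direction = Module.finrank ℝ F)
    (h : AutTransitiveOnExtreme S) :
    ∃ φ : E →ᵃ[ℝ] F, InjOn φ S ∧ affineSpan ℝ (φ '' S) = ⊤ ∧
      AutTransitiveOnExtreme (φ '' S) := by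
  obtain ⟨φ, ψ, hφψ, hψ⟩ := exists_affineMap_leftInverse_range_eq_affineSpan hne hdim
  have hinj : InjOn φ (range ψ) := by
    rintro _ ⟨x, rfl⟩ _ ⟨y, rfl⟩ hxy
    rw [hφψ, hφψ] at hxy
    rw [hxy]
  refine ⟨φ, hinj.mono (hψ ▸ subset_affineSpan ℝ S), ?_, h.image hS hφψ hψ⟩
  rw [← AffineSubspace.map_span, eq_top_iff]
  intro y _
  refine ⟨ψ y, ?_, hφψ y⟩
  rw [← hψ]
  exact mem_range_self y

end Transfer

section Circle

open scoped Pointwise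

theorem Circle.dense_of_infinite {H : Subgroup Circle} (hH : (H : Set Circle).Infinite) :
    Dense (H : Set Circle) := by
  have hsurj : Function.Surjective Circle.exp := Circle.exp_surjective
  let A : AddSubgroup ℝ := (Subgroup.toAddSubgroup H).comap Circle.expHom
  have hA : ∀ t, t ∈ A ↔ Circle.exp t ∈ H := fun t ↦ Iff.rfl
  have himg : Circle.exp '' (A : Set ℝ) = H := by
    ext z
    obtain ⟨t, rfl⟩ := hsurj z
    refine ⟨?_, fun h ↦ ⟨t, h, rfl⟩⟩
    rintro ⟨s, hs, hst⟩
    rw [← hst]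
    exact hs
  rcases A.dense_or_cyclic with hd | ⟨a, ha⟩
  · rw [← himg]
    exact hsurj.denseRange.dense_image Circle.exp.continuous hd
  · exfalso
    rw [← AddSubgroup.zmultiples_eq_closure] at ha
    have h2 : 2 * Real.pi ∈ A := by
      rw [hA, Circle.exp_two_pi]
      exact H.one_mem
    rw [ha, AddSubgroup.mem_zmultiples_iff] at h2
    obtain ⟨n, hn⟩ := h2
    have hn0 : n ≠ 0 := by
      rintro rfl
      rw [zero_smul] at hn
      exact Real.two_pi_pos.ne hn
    have hfin : IsOfFinOrder (Circle.exp a) := by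
      rw [isOfFinOrder_iff_zpow_eq_one]
      exact ⟨n, hn0, by rw [← Circle.exp_zsmul, hn, Circle.exp_two_pi]⟩
    refine hH (hfin.finite_zpowers.subset ?_)
    rw [← himg, ha]
    rintro _ ⟨_, ⟨k, rfl⟩, rfl⟩
    exact ⟨k, (Circle.exp_zsmul a k).symm⟩

theorem infinite_stabilizer_circle {K X : Set ℂ} (hX : X.Infinite)
    (htrans : ∀ x ∈ X, ∀ y ∈ X, ∃ f : ℂ ≃ₗᵢ[ℝ] ℂ, f '' K = K ∧ f x = y) :
    (MulAction.stabilizer Circle K : Set Circle).Infinite := by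
  obtain ⟨x, hx⟩ := hX.nonempty
  intro hfin
  let R : Set Circle := {a | a • (Complex.conjLIE '' K) = K}
  have hR : R.Finite := by
    rcases R.eq_empty_or_nonempty with h | ⟨b, hb⟩
    · simp [h]
    · refine (hfin.image (· * b)).subset fun a ha ↦ ⟨a * b⁻¹, ?_, by simp⟩
      change a • (Complex.conjLIE '' K) = K at ha
      change b • (Complex.conjLIE '' K) = K at hb
      rw [SetLike.mem_coe, MulAction.mem_stabilizer_iff]
      nth_rewrite 1 [← hb]
      rw [smul_smul, inv_mul_cancel_right, ha]
  refine hX (((hfin.image (· • x)).union (hR.image (· • Complex.conjLIE x))).subset ?_)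
  intro y hy
  obtain ⟨f, hf, rfl⟩ := htrans x hx y hy
  obtain ⟨a, rfl | rfl⟩ := linear_isometry_complex f
  · exact .inl ⟨a, hf, rfl⟩
  · refine .inr ⟨a, ?_, rfl⟩
    change a • (Complex.conjLIE '' K) = K
    conv_rhs => rw [← hf]
    exact image_image (a • ·) Complex.conjLIE K

theorem eq_closedBall_of_isometry_transitive {K : Set ℂ} (hK : IsCompact K)
    (hconv : Convex ℝ K) (hinf : (extremePoints ℝ K).Infinite)
    (htrans : ∀ x ∈ extremePoints ℝ K, ∀ y ∈ extremePoints ℝ K,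
      ∃ f : ℂ ≃ₗᵢ[ℝ] ℂ, f '' K = K ∧ f x = y) :
    ∃ r > 0, K = closedBall 0 r := by
  obtain ⟨x, hx⟩ := hinf.nonempty
  have hnorm : ∀ y ∈ extremePoints ℝ K, ‖y‖ = ‖x‖ := by
    intro y hy
    obtain ⟨f, -, rfl⟩ := htrans x hx y hy
    exact f.norm_map x
  have hr : 0 < ‖x‖ := by
    rw [norm_pos_iff]
    rintro rfl
    exact hinf ((finite_singleton 0).subset fun y hy ↦ by simpa using hnorm y hy)
  refine ⟨‖x‖, hr, subset_antisymm ?_ ?_⟩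
  · rw [← closure_convexHull_extremePoints hK hconv]
    refine closure_minimal (convexHull_min (fun y hy ↦ ?_) (convex_closedBall _ _))
      isClosed_closedBall
    simp [hnorm y hy]
  · rw [← convexHull_sphere_eq_closedBall _ hr.le]
    refine convexHull_min (fun y hy ↦ ?_) hconv
    have hdense := Circle.dense_of_infinite (infinite_stabilizer_circle hinf htrans)
    have hclosed : IsClosed {a : Circle | (a : ℂ) * x ∈ K} :=
      hK.isClosed.preimage (by fun_prop)
    have hmem : ∀ a : Circle, (a : ℂ) * x ∈ K := by
      intro a
      refine hclosed.closure_subset_iff.2 (fun b hb ↦ ?_) (hdense a)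
      have hb' : b • K = K := hb
      change b • x ∈ K
      rw [← hb']
      exact smul_mem_smul_set hx.1
    have hx0 : x ≠ 0 := norm_pos_iff.1 hr
    have hyx : ‖y / x‖ = 1 := by
      rw [norm_div, mem_sphere_zero_iff_norm.1 hy, div_self hr.ne']
    simpa [hx0] using hmem ⟨y / x, mem_sphere_zero_iff_norm.2 hyx⟩

end Circle

section Moments

variable {E : Type*} [NormedAddCommGroup E] [NormedSpace ℝ E]

theorem AffineEquiv.apply_eq_linear_add (f : E ≃ᵃ[ℝ] E) (x : E) : f x = f.linear x + f 0 := by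
  simpa using f.map_vadd 0 x

variable [FiniteDimensional ℝ E] [MeasurableSpace E] [BorelSpace E]
  {μ : Measure E} [μ.IsAddHaarMeasure]

theorem abs_det_linear_eq_one_of_image_eq {K : Set E} (h0 : μ K ≠ 0) (htop : μ K ≠ ⊤)
    (f : E ≃ᵃ[ℝ] E) (hf : f '' K = K) : |LinearMap.det (f.linear : E →ₗ[ℝ] E)| = 1 := by
  have himg : (fun y ↦ y + f 0) '' ((f.linear : E →ₗ[ℝ] E) '' K) = K := by
    rw [image_image]
    conv_rhs => rw [← hf]
    exact image_congr fun x _ ↦ (f.apply_eq_linear_add x).symm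
  have hμ : ENNReal.ofReal |LinearMap.det (f.linear : E →ₗ[ℝ] E)| * μ K = 1 * μ K := by
    rw [← Measure.addHaar_image_linearMap, one_mul]
    conv_rhs => rw [← himg]
    rw [image_add_right, measure_preimage_add_right]
  rw [ENNReal.mul_left_inj h0 htop] at hμ
  simpa using hμ

theorem measurePreserving_restrict_of_image_eq {K : Set E} (h0 : μ K ≠ 0) (htop : μ K ≠ ⊤)
    (f : E ≃ᵃ[ℝ] E) (hf : f '' K = K) :
    MeasurePreserving f (μ.restrict K) (μ.restrict K) ∧ MeasurableEmbedding f := by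
  have hdet := abs_det_linear_eq_one_of_image_eq h0 htop f hf
  have hemb : MeasurableEmbedding f :=
    (AffineEquiv.toContinuousAffineEquiv f).toHomeomorph.measurableEmbedding
  have hlin : MeasurePreserving (f.linear : E →ₗ[ℝ] E) μ μ := by
    refine ⟨(LinearMap.continuous_of_finiteDimensional _).measurable, ?_⟩
    rw [Measure.map_linearMap_addHaar_eq_smul_addHaar μ fun h ↦ by simp [h] at hdet, abs_inv, hdet]
    simp
  have hmp : MeasurePreserving f μ μ := by
    have := (measurePreserving_add_right μ (f 0)).comp hlin
    convert this using 1
    exact funext f.apply_eq_linear_add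
  refine ⟨?_, hemb⟩
  have := hmp.restrict_preimage_emb hemb K
  rwa [← hf, preimage_image_eq _ f.injective, hf] at this

theorem map_setAverage_of_image_eq {K : Set E} (hK : IsCompact K) (h0 : μ K ≠ 0)
    (f : E ≃ᵃ[ℝ] E) (hf : f '' K = K) : f (⨍ x in K, x ∂μ) = ⨍ x in K, x ∂μ := by
  have htop : μ K ≠ ⊤ := hK.measure_lt_top.ne
  obtain ⟨hmp, hemb⟩ := measurePreserving_restrict_of_image_eq h0 htop f hf
  have hint : IntegrableOn (fun x : E ↦ x) K μ := continuousOn_id.integrableOn_compact hK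
  have : IsFiniteMeasure (μ.restrict K) := ⟨by simpa using hK.measure_lt_top⟩
  have hK' : μ.real K ≠ 0 := (ENNReal.toReal_pos h0 htop).ne'
  have hcomp : ∫ x in K, f x ∂μ = ∫ x in K, x ∂μ := hmp.integral_comp hemb fun x ↦ x
  have hL : ∫ x in K, f.linear x ∂μ = f.linear (∫ x in K, x ∂μ) :=
    (LinearMap.toContinuousLinearMap (f.linear : E →ₗ[ℝ] E)).integral_comp_comm hint
  have hsplit : ∫ x in K, f x ∂μ = f.linear (∫ x in K, x ∂μ) + μ.real K • f 0 := by
    rw [integral_congr_ae (.of_forall f.apply_eq_linear_add), integral_add _ (integrable_const _), hL]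
    · simp
    · exact (LinearMap.toContinuousLinearMap (f.linear : E →ₗ[ℝ] E)).integrable_comp hint
  rw [setAverage_eq, f.apply_eq_linear_add, map_smul]
  conv_rhs => rw [← hcomp, hsplit, smul_add, smul_smul, inv_mul_cancel₀ hK', one_smul]

end Moments

section InvariantForm

/-- The determinant of the pair `z, w` of vectors of the plane. -/
def planeDet (z w : ℂ) : ℝ := z.re * w.im - z.im * w.re

theorem planeDet_map (L : ℂ →ₗ[ℝ] ℂ) (z w : ℂ) :
    planeDet (L z) (L w) = LinearMap.det L * planeDet z w := by
  have hL : ∀ z : ℂ, L z = (z.re : ℂ) * L 1 + (z.im : ℂ) * L Complex.I := by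
    intro z
    have hz : z = z.re • (1 : ℂ) + z.im • Complex.I := by simp
    conv_lhs => rw [hz]
    rw [map_add, map_smul, map_smul, Complex.real_smul, Complex.real_smul]
  rw [← LinearMap.det_toMatrix Complex.basisOneI, Matrix.det_fin_two, hL z, hL w]
  simp [planeDet, LinearMap.toMatrix_apply]
  ring

/-- A positive definite binary quadratic form is the square of the norm in suitable linear
coordinates. -/
theorem exists_linearEquiv_norm_sq_eq {a b d : ℝ}
    (hpos : ∀ z : ℂ, z ≠ 0 → 0 < a * z.re ^ 2 + 2 * b * z.re * z.im + d * z.im ^ 2) :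
    ∃ T : ℂ ≃ₗ[ℝ] ℂ, ∀ z,
      ‖T z‖ ^ 2 = a * z.re ^ 2 + 2 * b * z.re * z.im + d * z.im ^ 2 := by
  have ha : 0 < a := by simpa using hpos 1 one_ne_zero
  have hdisc : 0 < d - b ^ 2 / a := by
    have h := hpos ⟨-(b / a), 1⟩ fun h ↦ by simpa using congrArg Complex.im h
    convert h using 1
    field_simp
    ring
  let B : ℂ →ₗ[ℝ] ℂ :=
    { toFun z := ⟨√a * z.re + b / √a * z.im, √(d - b ^ 2 / a) * z.im⟩
      map_add' z w := by apply Complex.ext <;> simp <;> ring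
      map_smul' r z := by apply Complex.ext <;> simp <;> ring }
  have hB : ∀ z, ‖B z‖ ^ 2 = a * z.re ^ 2 + 2 * b * z.re * z.im + d * z.im ^ 2 := by
    intro z
    have hsa : √a ^ 2 = a := Real.sq_sqrt ha.le
    have hsa0 : √a ≠ 0 := (Real.sqrt_pos.2 ha).ne'
    have hsd : √(d - b ^ 2 / a) ^ 2 = d - b ^ 2 / a := Real.sq_sqrt hdisc.le
    rw [Complex.sq_norm, Complex.normSq_apply]
    change (√a * z.re + b / √a * z.im) * (√a * z.re + b / √a * z.im) +
      √(d - b ^ 2 / a) * z.im * (√(d - b ^ 2 / a) * z.im) = _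
    calc _ = √a ^ 2 * z.re ^ 2 + 2 * b * (√a / √a) * z.re * z.im + b ^ 2 / √a ^ 2 * z.im ^ 2
          + √(d - b ^ 2 / a) ^ 2 * z.im ^ 2 := by ring
      _ = _ := by rw [hsa, hsd, div_self hsa0]; ring
  have hinj : Function.Injective B := by
    rw [injective_iff_map_eq_zero]
    intro z hz
    by_contra hne
    have := hpos z hne
    rw [← hB, hz] at this
    simp at this
  exact ⟨LinearEquiv.ofInjectiveEndo B hinj, hB⟩

/-- The affine automorphisms of a planar convex body are isometries fixing the origin in suitable
affine coordinates. -/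
theorem exists_affineEquiv_norm_map_eq {K : Set ℂ} (hK : IsCompact K)
    (hint : (interior K).Nonempty) :
    ∃ T : ℂ ≃ᵃ[ℝ] ℂ, ∀ f : ℂ ≃ᵃ[ℝ] ℂ, f '' K = K → ∀ x, ‖T (f x)‖ = ‖T x‖ := by
  have h0 : volume K ≠ 0 :=
    ((isOpen_interior.measure_pos volume hint).trans_le (measure_mono interior_subset)).ne'
  have htop : volume K ≠ ⊤ := hK.measure_lt_top.ne
  set c : ℂ := ⨍ x in K, x
  let q : ℂ → ℝ := fun z ↦ ∫ x in K, planeDet z (x - c) ^ 2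
  have hintegrable : ∀ g : ℂ → ℝ, Continuous g → IntegrableOn g K := fun g hg ↦
    hg.continuousOn.integrableOn_compact hK
  have hq : ∀ z, q z = (∫ x in K, (x - c).im ^ 2) * z.re ^ 2
      + 2 * (-∫ x in K, (x - c).re * (x - c).im) * z.re * z.im
      + (∫ x in K, (x - c).re ^ 2) * z.im ^ 2 := by
    intro z
    have hexp : ∀ x : ℂ, planeDet z (x - c) ^ 2 = z.re ^ 2 * (x - c).im ^ 2
        + -2 * z.re * z.im * ((x - c).re * (x - c).im) + z.im ^ 2 * (x - c).re ^ 2 := by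
      intro x
      simp only [planeDet]
      ring
    simp only [q, hexp]
    rw [integral_add, integral_add, integral_const_mul, integral_const_mul, integral_const_mul]
    · ring
    all_goals exact hintegrable _ (by fun_prop)
  have hqpos : ∀ z, z ≠ 0 → 0 < q z := by
    intro z hz
    have hcont : Continuous fun x : ℂ ↦ planeDet z (x - c) ^ 2 := by
      unfold planeDet
      fun_prop
    rw [setIntegral_pos_iff_support_of_nonneg_ae (.of_forall fun x ↦ sq_nonneg _)
      (hintegrable _ hcont)]
    refine (IsOpen.measure_pos volume (hcont.isOpen_support.inter isOpen_interior) ?_).trans_le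
      (measure_mono (inter_subset_inter_right _ interior_subset))
    by_contra hempty
    rw [not_nonempty_iff_eq_empty] at hempty
    have hzero : ∀ x ∈ interior K, planeDet z (x - c) = 0 := by
      intro x hx
      by_contra hne
      exact hempty.subset ⟨pow_ne_zero 2 hne, hx⟩
    obtain ⟨p, hp⟩ := hint
    have hnhds : ∀ᶠ t : ℝ in nhds 0, p + t * (Complex.I * z) ∈ interior K := by
      refine ContinuousAt.eventually_mem (by fun_prop) ?_
      simpa using isOpen_interior.mem_nhds hp
    obtain ⟨t, ht, ht0⟩ :=
      ((hnhds.filter_mono nhdsWithin_le_nhds).and (self_mem_nhdsWithin (s := {(0 : ℝ)}ᶜ))).exists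
    have h1 := hzero p hp
    have h2 := hzero _ ht
    have h3 : t * (z.re ^ 2 + z.im ^ 2) = 0 := by
      simp [planeDet] at h1 h2
      linear_combination h2 - h1
    rcases mul_eq_zero.1 h3 with h | h
    · exact ht0 h
    · refine hz (Complex.normSq_eq_zero.1 ?_)
      rw [Complex.normSq_apply]
      linear_combination h
  have hqinv : ∀ f : ℂ ≃ᵃ[ℝ] ℂ, f '' K = K → ∀ x, q (f x - c) = q (x - c) := by
    intro f hf x
    obtain ⟨hmp, hemb⟩ := measurePreserving_restrict_of_image_eq h0 htop f hf
    have hdet := abs_det_linear_eq_one_of_image_eq h0 htop f hf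
    have hfc : f c = c := map_setAverage_of_image_eq hK h0 f hf
    have hlin : ∀ y, f y - c = (f.linear : ℂ →ₗ[ℝ] ℂ) (y - c) := by
      intro y
      conv_lhs => rw [← hfc]
      exact (f.toAffineMap.linearMap_vsub y c).symm
    change ∫ y in K, planeDet (f x - c) (y - c) ^ 2 = _
    rw [← hmp.integral_comp hemb]
    refine integral_congr_ae (.of_forall fun y ↦ ?_)
    change planeDet (f x - c) (f y - c) ^ 2 = planeDet (x - c) (y - c) ^ 2
    rw [hlin, hlin, planeDet_map, mul_pow, ← sq_abs, hdet, one_pow, one_mul]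
  obtain ⟨T, hT⟩ := exists_linearEquiv_norm_sq_eq fun z hz ↦ hq z ▸ hqpos z hz
  refine ⟨(AffineEquiv.constVAdd ℝ ℂ (-c)).trans T.toAffineEquiv, fun f hf x ↦ ?_⟩
  have hTx : ∀ y, ((AffineEquiv.constVAdd ℝ ℂ (-c)).trans T.toAffineEquiv) y = T (y - c) := by
    intro y
    simp [sub_eq_neg_add]
  rw [← sq_eq_sq₀ (norm_nonneg _) (norm_nonneg _), hTx, hTx, hT, hT, ← hq, ← hq, hqinv f hf]

end InvariantForm

section Plane

/-- An affine self-equivalence of a normed space preserving the norm is a linear isometry. -/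
def AffineEquiv.toLinearIsometryEquivOfNorm {E : Type*} [NormedAddCommGroup E] [NormedSpace ℝ E]
    (f : E ≃ᵃ[ℝ] E) (hf : ∀ x, ‖f x‖ = ‖x‖) : E ≃ₗᵢ[ℝ] E where
  toLinearEquiv := f.linear
  norm_map' x := by
    have h0 : f 0 = 0 := by simpa using hf 0
    rw [← hf x, f.apply_eq_linear_add x, h0, add_zero]

theorem AffineEquiv.coe_toLinearIsometryEquivOfNorm {E : Type*} [NormedAddCommGroup E]
    [NormedSpace ℝ E] (f : E ≃ᵃ[ℝ] E) (hf : ∀ x, ‖f x‖ = ‖x‖) :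
    ⇑(f.toLinearIsometryEquivOfNorm hf) = f := by
  have h0 : f 0 = 0 := by simpa using hf 0
  funext x
  rw [f.apply_eq_linear_add x, h0, add_zero]
  rfl

theorem exists_affineEquiv_image_eq_closedBall {K : Set ℂ} (hK : IsCompact K)
    (hconv : Convex ℝ K) (hint : (interior K).Nonempty) (htrans : AutTransitiveOnExtreme K)
    (hinf : (extremePoints ℝ K).Infinite) :
    ∃ T : ℂ ≃ᵃ[ℝ] ℂ, ∃ r > 0, T '' K = closedBall 0 r := by
  obtain ⟨T, hT⟩ := exists_affineEquiv_norm_map_eq hK hint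
  have hext : T '' extremePoints ℝ K = extremePoints ℝ (T '' K) :=
    image_extremePoints_of_injOn hconv (φ := T.toAffineMap) T.injective.injOn
  refine ⟨T, eq_closedBall_of_isometry_transitive
    (hK.image T.toAffineMap.continuous_of_finiteDimensional)
    (hconv.affine_image T.toAffineMap) ?_ ?_⟩
  · rw [← hext]
    exact hinf.image T.injective.injOn
  · rw [← hext]
    rintro _ ⟨x, hx, rfl⟩ _ ⟨y, hy, rfl⟩
    obtain ⟨f, hf, rfl⟩ := htrans x hx y hy
    have hnorm : ∀ z, ‖(T.symm.trans (f.trans T)) z‖ = ‖z‖ := by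
      intro z
      simpa using hT f hf (T.symm z)
    refine ⟨(T.symm.trans (f.trans T)).toLinearIsometryEquivOfNorm hnorm, ?_, ?_⟩
    · rw [AffineEquiv.coe_toLinearIsometryEquivOfNorm, image_image]
      conv_rhs => rw [← hf, image_image]
      exact image_congr fun z _ ↦ by simp
    · simp [AffineEquiv.coe_toLinearIsometryEquivOfNorm]

/-- A closed disk in the complex plane is affinely equivalent to the Euclidean unit disk. -/
theorem exists_affineMap_injective_image_closedBall {r : ℝ} (hr : 0 < r) :
    ∃ g : ℂ →ᵃ[ℝ] EuclideanSpace ℝ (Fin 2), Function.Injective g ∧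
      g '' closedBall 0 r = closedBall 0 1 := by
  let u := Complex.orthonormalBasisOneI.repr
  have hr' : r⁻¹ ≠ 0 := inv_ne_zero hr.ne'
  refine ⟨(r⁻¹ • u.toLinearEquiv.toLinearMap).toAffineMap,
    (smul_right_injective _ hr').comp u.injective, ?_⟩
  have himg : ((r⁻¹ • u.toLinearEquiv.toLinearMap).toAffineMap : ℂ → EuclideanSpace ℝ (Fin 2)) =
      (r⁻¹ • ·) ∘ u := rfl
  rw [himg, image_comp, u.image_closedBall, image_smul, smul_closedBall' hr', map_zero, smul_zero,
    Real.norm_of_nonneg (inv_nonneg.2 hr.le), inv_mul_cancel₀ hr.ne']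

end Plane

/-- Theorem: a compact convex set with 2-dimensional affine hull on whose extreme points the
affine automorphism group acts transitively is affinely isomorphic to a vertex-transitive
convex polygon or to the closed unit disk. -/
theorem two_dimensional_symmetric {d : ℕ} (S : Set (EuclideanSpace ℝ (Fin d)))
    (hScompact : IsCompact S) (hSconvex : Convex ℝ S)
    (hdim : Module.finrank ℝ (affineSpan ℝ S).direction = 2)
    (htrans : AutTransitiveOnExtreme S) :
    (∃ P : Set (EuclideanSpace ℝ (Fin 2)),
      (∃ t : Finset (EuclideanSpace ℝ (Fin 2)), P = convexHull ℝ (t : Set (EuclideanSpace ℝ (Fin 2)))) ∧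
      affineSpan ℝ P = ⊤ ∧ AutTransitiveOnExtreme P ∧ AffIso S P) ∨
    AffIso S (Metric.closedBall (0 : EuclideanSpace ℝ (Fin 2)) 1) := by
  have hne : S.Nonempty := by
    rw [nonempty_iff_ne_empty]
    rintro rfl
    rw [AffineSubspace.span_empty, AffineSubspace.direction_bot, finrank_bot] at hdim
    exact absurd hdim (by norm_num)
  by_cases hfin : (extremePoints ℝ S).Finite
  · left
    obtain ⟨φ, hinj, hspan, htrans'⟩ := exists_affineMap_injOn_autTransitiveOnExtreme_image
      (F := EuclideanSpace ℝ (Fin 2)) hne hSconvex (by rw [hdim, finrank_euclideanSpace_fin])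
      htrans
    have hfin' : (extremePoints ℝ (φ '' S)).Finite := by
      rw [← image_extremePoints_of_injOn hSconvex hinj]
      exact hfin.image φ
    refine ⟨φ '' S, ⟨hfin'.toFinset, ?_⟩, hspan, htrans', φ, hinj, rfl⟩
    rw [hfin'.coe_toFinset, ← (hfin'.isClosed_convexHull ℝ).closure_eq,
      closure_convexHull_extremePoints (hScompact.image φ.continuous_of_finiteDimensional)
        (hSconvex.affine_image φ)]
  · right
    obtain ⟨φ, hinj, hspan, htrans'⟩ := exists_affineMap_injOn_autTransitiveOnExtreme_image
      (F := ℂ) hne hSconvex (by rw [hdim, Complex.finrank_real_complex]) htrans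
    have hconv : Convex ℝ (φ '' S) := hSconvex.affine_image φ
    have hinf : (extremePoints ℝ (φ '' S)).Infinite := by
      rw [← image_extremePoints_of_injOn hSconvex hinj]
      exact Set.Infinite.image (hinj.mono extremePoints_subset) hfin
    obtain ⟨T, r, hr, hT⟩ := exists_affineEquiv_image_eq_closedBall
      (hScompact.image φ.continuous_of_finiteDimensional) hconv
      (hconv.interior_nonempty_iff_affineSpan_eq_top.2 hspan) htrans' hinf
    obtain ⟨g, hg, hgr⟩ := exists_affineMap_injective_image_closedBall hr
    refine ⟨g.comp (T.toAffineMap.comp φ), hg.comp_injOn (T.injective.comp_injOn hinj), ?_⟩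
    rw [← hgr, ← hT, image_image, image_image]
    rfl
end
end

section
/- Let S be a compact finite-dimensional convex set whose group of bijective affine transformations acts transitively on the extreme points of S. Then S is affinely isomorphic to the closed unit ball (of dimension dim S) if and only if every boundary point of S is an extreme point of S. -/
noncomputable section

open MeasureTheory Set Module

theorem InnerProductSpace.Core.exists_linearEquiv_norm_sq {V : Type*} [AddCommGroup V]
    [Module ℝ V] [FiniteDimensional ℝ V] {n : ℕ} (hn : finrank ℝ V = n)
    (c : InnerProductSpace.Core ℝ V) :
    ∃ e : V ≃ₗ[ℝ] EuclideanSpace ℝ (Fin n), ∀ x, ‖e x‖ ^ 2 = c.inner x x := by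
  let := c.toNormedAddCommGroup
  let := InnerProductSpace.ofCore c.toCore
  refine ⟨((stdOrthonormalBasis ℝ V).reindex (finCongr hn)).repr.toLinearEquiv, fun x => ?_⟩
  have h : ‖((stdOrthonormalBasis ℝ V).reindex (finCongr hn)).repr x‖ = ‖x‖ :=
    LinearIsometryEquiv.norm_map _ _
  exact (congrArg (· ^ 2) h).trans (real_inner_self_eq_norm_sq x).symm

/-- If a linear equivalence `e` does not increase its norm along `adjoint A`, then its
contragredient does not increase its norm along `A`. -/
theorem norm_adjoint_symm_le {E F : Type*} [NormedAddCommGroup E] [InnerProductSpace ℝ E]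
    [FiniteDimensional ℝ E] [NormedAddCommGroup F] [InnerProductSpace ℝ F]
    [FiniteDimensional ℝ F] (e : E ≃ₗ[ℝ] F) (A : E →ₗ[ℝ] E)
    (hA : ∀ y, ‖e (A.adjoint y)‖ ≤ ‖e y‖) (v : E) :
    ‖e.symm.toLinearMap.adjoint (A v)‖ ≤ ‖e.symm.toLinearMap.adjoint v‖ := by
  set D := e.symm.toLinearMap.adjoint with hD
  have key : ∀ v y, inner ℝ (D v) (e y) = inner ℝ v y := fun v y => by
    simp [hD, LinearMap.adjoint_inner_left]
  have h1 : ‖D (A v)‖ * ‖D (A v)‖ ≤ ‖D v‖ * ‖D (A v)‖ := by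
    obtain ⟨y, hy⟩ := e.surjective (D (A v))
    calc ‖D (A v)‖ * ‖D (A v)‖ = inner ℝ (D (A v)) (e y) := by
          rw [hy, real_inner_self_eq_norm_mul_norm]
      _ = inner ℝ (D v) (e (A.adjoint y)) := by
          rw [key, key, LinearMap.adjoint_inner_right]
      _ ≤ ‖D v‖ * ‖e (A.adjoint y)‖ := real_inner_le_norm _ _
      _ ≤ ‖D v‖ * ‖D (A v)‖ := by
          rw [← hy]; exact mul_le_mul_of_nonneg_left (hA y) (norm_nonneg _)
  rcases (norm_nonneg (D (A v))).eq_or_lt with h | h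
  · rw [← h]; exact norm_nonneg _
  · exact le_of_mul_le_mul_right h1 h

theorem exists_ne_zero_add_smul_mem {E : Type*} [NormedAddCommGroup E] [NormedSpace ℝ E]
    {U : Set E} (hU : IsOpen U) {x : E} (hx : x ∈ U) (v : E) :
    ∃ t : ℝ, t ≠ 0 ∧ x + t • v ∈ U := by
  have hcont : Continuous fun t : ℝ => x + t • v := by fun_prop
  have hlim : ∀ᶠ t : ℝ in nhdsWithin 0 {0}ᶜ, x + t • v ∈ U :=
    (hcont.continuousAt.eventually_mem (by simpa using hU.mem_nhds hx)).filter_mono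
      nhdsWithin_le_nhds
  obtain ⟨t, ht, ht0⟩ := (hlim.and self_mem_nhdsWithin).exists
  exact ⟨t, ht0, ht⟩

section Automorphism

variable {E : Type*} [NormedAddCommGroup E] [InnerProductSpace ℝ E] [FiniteDimensional ℝ E]
  [MeasurableSpace E] [BorelSpace E] {S : Set E}

theorem measureReal_pos_of_isCompact (hS : IsCompact S) (hint : (interior S).Nonempty) :
    0 < (volume : Measure E).real S :=
  ENNReal.toReal_pos (Measure.measure_pos_of_nonempty_interior _ hint).ne' hS.measure_lt_top.ne

theorem AffineEquiv.setIntegral_comp_of_image_eq {F : Type*} [NormedAddCommGroup F]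
    [NormedSpace ℝ F] (hS : IsCompact S) (hint : (interior S).Nonempty) (f : E ≃ᵃ[ℝ] E)
    (hf : f '' S = S) (g : E → F) : ∫ x in S, g (f x) = ∫ x in S, g x := by
  have hderiv : ∀ x ∈ S, HasFDerivWithinAt f
      (LinearMap.toContinuousLinearMap (f.linear : E →ₗ[ℝ] E)) S x := by
    intro x _
    have h : (f : E → E) =
        fun x => LinearMap.toContinuousLinearMap (f.linear : E →ₗ[ℝ] E) x + f 0 :=
      f.toAffineMap.decomp
    rw [h]
    exact ((ContinuousLinearMap.hasFDerivAt _).add_const _).hasFDerivWithinAt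
  have hdet : |(LinearMap.toContinuousLinearMap (f.linear : E →ₗ[ℝ] E)).det| = 1 := by
    have h := integral_image_eq_integral_abs_det_fderiv_smul volume hS.measurableSet hderiv
      f.injective.injOn fun _ => (1 : ℝ)
    rw [hf, setIntegral_const, setIntegral_const, smul_eq_mul, smul_eq_mul, smul_eq_mul, mul_one,
      mul_one] at h
    exact (mul_eq_left₀ (measureReal_pos_of_isCompact hS hint).ne').1 h.symm
  have h := integral_image_eq_integral_abs_det_fderiv_smul volume hS.measurableSet hderiv
    f.injective.injOn g
  simpa only [hf, hdet, one_smul] using h.symm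

theorem AffineEquiv.apply_average_of_image_eq (hS : IsCompact S) (hint : (interior S).Nonempty)
    (f : E ≃ᵃ[ℝ] E) (hf : f '' S = S) : f (⨍ x in S, x) = ⨍ x in S, x := by
  have hpos := measureReal_pos_of_isCompact hS hint
  have hid : IntegrableOn (fun x : E => x) S := continuous_id.continuousOn.integrableOn_compact hS
  set A := LinearMap.toContinuousLinearMap (f.linear : E →ₗ[ℝ] E)
  have h : ∀ x, f x = A x + f 0 := congrFun f.toAffineMap.decomp
  have h1 := f.setIntegral_comp_of_image_eq hS hint hf (fun x => x)
  rw [integral_congr_ae (.of_forall h),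
    integral_add (A.integrable_comp hid) (integrableOn_const hS.measure_lt_top.ne),
    A.integral_comp_comm hid, setIntegral_const] at h1
  rw [h, setAverage_eq, map_smul]
  nth_rewrite 2 [← h1]
  rw [smul_add, smul_smul, inv_mul_cancel₀ hpos.ne', one_smul]

/-- The covariance form of the uniform measure on `S` about the point `c`. -/
@[reducible]
def covarianceCore (hS : IsCompact S) (hint : (interior S).Nonempty) (c : E) :
    InnerProductSpace.Core ℝ E where
  inner y z := ∫ x in S, inner ℝ (x - c) y * inner ℝ (x - c) z
  conj_inner_symm y z := by simp [mul_comm]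
  re_inner_nonneg y := by
    simpa using integral_nonneg fun x => mul_self_nonneg (inner ℝ (x - c) y)
  add_left y z w := by
    simp only [inner_add_right, add_mul]
    exact integral_add (Continuous.continuousOn (by fun_prop) |>.integrableOn_compact hS)
      (Continuous.continuousOn (by fun_prop) |>.integrableOn_compact hS)
  smul_left y z r := by
    simp only [inner_smul_right, mul_assoc, integral_const_mul]
    simp
  definite y hy := by
    have hcont : Continuous fun x : E => inner ℝ (x - c) y * inner ℝ (x - c) y := by fun_prop
    have h0 := (setIntegral_eq_zero_iff_of_nonneg_ae
      (Filter.Eventually.of_forall fun x => mul_self_nonneg (inner ℝ (x - c) y))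
      (hcont.continuousOn.integrableOn_compact hS)).1 hy
    have h1 : EqOn _ _ (interior S) := Measure.eqOn_open_of_ae_eq
      (ae_restrict_of_ae_restrict_of_subset interior_subset h0) isOpen_interior
      hcont.continuousOn continuousOn_const
    obtain ⟨x, hx⟩ := hint
    obtain ⟨t, ht0, ht⟩ := exists_ne_zero_add_smul_mem isOpen_interior hx y
    have hx0 : inner ℝ (x - c) y = 0 := by simpa using h1 hx
    have ht1 : inner ℝ (x + t • y - c) y = 0 := by simpa using h1 ht
    rw [add_sub_right_comm, inner_add_left, hx0, zero_add, real_inner_smul_left] at ht1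
    simpa [ht0] using ht1

/-- A compact set with nonempty interior has linear coordinates in which none of its affine
automorphisms increases the distance to the centroid. -/
theorem exists_linearEquiv_norm_automorphism_le {n : ℕ} (hn : finrank ℝ E = n) (hS : IsCompact S)
    (hint : (interior S).Nonempty) :
    ∃ (c : E) (D : E ≃ₗ[ℝ] EuclideanSpace ℝ (Fin n)), ∀ f : E ≃ᵃ[ℝ] E, f '' S = S →
      ∀ x, ‖D (f x - c)‖ ≤ ‖D (x - c)‖ := by
  set c : E := ⨍ x in S, x
  obtain ⟨e, he⟩ := (covarianceCore hS hint c).exists_linearEquiv_norm_sq hn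
  have hinj : Function.Injective e.symm.toLinearMap.adjoint := by
    rw [injective_iff_map_eq_zero]
    intro v hv
    have : inner ℝ (e.symm.toLinearMap.adjoint v) (e v) = inner ℝ v v := by
      simp [LinearMap.adjoint_inner_left]
    rw [hv, inner_zero_left] at this
    exact inner_self_eq_zero.1 this.symm
  refine ⟨c, LinearMap.linearEquivOfInjective _ hinj (by simp [hn]), fun f hf x => ?_⟩
  have hfc : f c = c := f.apply_average_of_image_eq hS hint hf
  have hlin : ∀ x, f x - c = f.linear (x - c) := fun x => by
    conv_lhs => rw [← hfc]
    exact (f.toAffineMap.linearMap_vsub x c).symm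
  rw [hlin]
  refine norm_adjoint_symm_le e f.linear (fun y => ?_) (x - c)
  refine (sq_le_sq₀ (norm_nonneg _) (norm_nonneg _)).1 (le_of_eq ?_)
  rw [he, he]
  refine Eq.trans ?_ (f.setIntegral_comp_of_image_eq hS hint hf
    fun x => inner ℝ (x - c) y * inner ℝ (x - c) y)
  change ∫ x in S, inner ℝ (x - c) (LinearMap.adjoint (f.linear : E →ₗ[ℝ] E) y) *
    inner ℝ (x - c) (LinearMap.adjoint (f.linear : E →ₗ[ℝ] E) y) = _
  simp only [hlin, LinearMap.adjoint_inner_right]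
  rfl

end Automorphism

theorem eq_closedBall_of_frontier_subset_sphere {E : Type*} [NormedAddCommGroup E]
    [NormedSpace ℝ E] {T : Set E} {a : E} {r : ℝ} (hT : IsClosed T)
    (hint : (interior T).Nonempty) (hr : r ≠ 0) (hsub : T ⊆ Metric.closedBall a r)
    (hfront : frontier T ⊆ Metric.sphere a r) : T = Metric.closedBall a r := by
  refine hsub.antisymm ?_
  have hball : interior T ⊆ Metric.ball a r := by
    rw [← interior_closedBall a hr]; exact interior_mono hsub
  have hcover : Metric.ball a r ⊆ interior T ∪ Tᶜ := by
    intro x hx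
    by_cases hxT : x ∈ T
    · left
      by_contra hxi
      have h := hfront ((mem_frontier_iff_notMem_interior hxT).2 hxi)
      exact (Metric.mem_ball.1 hx).ne (Metric.mem_sphere.1 h)
    · exact Or.inr hxT
  obtain ⟨x, hx⟩ := hint
  have h : Metric.ball a r ⊆ interior T :=
    (convex_ball a r).isPreconnected.subset_left_of_subset_union isOpen_interior hT.isOpen_compl
      (disjoint_compl_right.mono_left interior_subset) hcover ⟨x, hball hx, hx⟩
  rw [← closure_ball a hr]
  exact closure_minimal (h.trans interior_subset) hT

theorem AffIso.frontier_subset_extremePoints {E F : Type*} [NormedAddCommGroup E]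
    [NormedSpace ℝ E] [FiniteDimensional ℝ E] [NormedAddCommGroup F] [NormedSpace ℝ F]
    {S : Set E} {T : Set F} (hS : IsClosed S) (hint : (interior S).Nonempty)
    (hT : StrictConvex ℝ T) (h : AffIso S T) : frontier S ⊆ Set.extremePoints ℝ S := by
  obtain ⟨f, hinj, rfl⟩ := h
  have hf : Continuous f := f.continuous_of_finiteDimensional
  have hfinj : Function.Injective f := by
    rw [← AffineMap.linear_injective_iff, injective_iff_map_eq_zero]
    intro v hv
    obtain ⟨x, hx⟩ := hint
    obtain ⟨t, ht0, ht⟩ := exists_ne_zero_add_smul_mem isOpen_interior hx v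
    have heq : f (x + t • v) = f x := by
      have := f.map_vadd x (t • v)
      simpa [hv, add_comm] using this
    simpa [ht0] using hinj (interior_subset ht) (interior_subset hx) heq
  intro x hx
  have hxS : x ∈ S := hS.frontier_subset hx
  refine ⟨hxS, fun a ha b hb hab => ?_⟩
  by_contra hne
  have hab' : a ≠ b := by
    rintro rfl
    rw [openSegment_same] at hab
    exact hne hab.symm
  have hfx : f x ∈ interior (f '' S) := by
    refine hT.openSegment_subset (mem_image_of_mem f ha) (mem_image_of_mem f hb)
      (hfinj.ne hab') ?_
    rw [← image_openSegment]
    exact mem_image_of_mem f hab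
  refine hx.2 (mem_interior.2 ⟨f ⁻¹' interior (f '' S), ?_, isOpen_interior.preimage hf, hfx⟩)
  exact (preimage_mono interior_subset).trans (preimage_image_eq S hfinj).subset

theorem affIso_closedBall_of_frontier_subset_extremePoints {E : Type*} [NormedAddCommGroup E]
    [InnerProductSpace ℝ E] [FiniteDimensional ℝ E] {n : ℕ} (hn : finrank ℝ E = n) {S : Set E}
    (hS : IsCompact S) (hconv : Convex ℝ S) (hint : (interior S).Nonempty)
    (htrans : AutTransitiveOnExtreme S) (hfront : frontier S ⊆ Set.extremePoints ℝ S) :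
    AffIso S (Metric.closedBall (0 : EuclideanSpace ℝ (Fin n)) 1) := by
  borelize E
  obtain ⟨c, D, hD⟩ := exists_linearEquiv_norm_automorphism_le hn hS hint
  obtain ⟨p, hp⟩ := hS.extremePoints_nonempty (hint.mono interior_subset)
  let h : E ≃ᵃ[ℝ] EuclideanSpace ℝ (Fin n) :=
    (AffineEquiv.constVAdd ℝ E (-c)).trans D.toAffineEquiv
  have hh : ∀ x, h x = D (x - c) := fun x => by simp [h, sub_eq_neg_add]
  have hext : ∀ x ∈ Set.extremePoints ℝ S, ‖h x‖ = ‖h p‖ := by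
    intro x hx
    obtain ⟨f, hf, rfl⟩ := htrans p hp x hx
    obtain ⟨g, hg, hgp⟩ := htrans (f p) hx p hp
    have h1 := hD f hf p
    have h2 := hD g hg (f p)
    rw [hgp] at h2
    rw [hh, hh]
    exact h1.antisymm h2
  have hcont : Continuous h := h.toAffineMap.continuous_of_finiteDimensional
  let H : E ≃ₜ EuclideanSpace ℝ (Fin n) :=
    { h.toEquiv with
      continuous_toFun := hcont
      continuous_invFun := h.symm.toAffineMap.continuous_of_finiteDimensional }
  have hHh : ∀ s, H '' s = h '' s := fun _ => rfl
  have hsub : h '' S ⊆ Metric.closedBall 0 ‖h p‖ := by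
    rw [image_subset_iff, ← closure_convexHull_extremePoints hS hconv]
    refine closure_minimal (convexHull_min ?_ ?_) (Metric.isClosed_closedBall.preimage hcont)
    · intro x hx
      simpa using (hext x hx).le
    · exact (convex_closedBall _ _).affine_preimage h.toAffineMap
  have hTint : (interior (h '' S)).Nonempty := by
    rw [← hHh, ← H.image_interior]
    exact hint.image _
  by_cases hr : ‖h p‖ = 0
  · rw [hr, Metric.closedBall_zero] at hsub
    have hsing : IsOpen ({0} : Set (EuclideanSpace ℝ (Fin n))) := by
      obtain ⟨y, hy⟩ := hTint
      have : interior (h '' S) = {0} :=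
        (Set.Nonempty.subset_singleton_iff ⟨y, hy⟩).1 (interior_subset.trans hsub)
      exact this ▸ isOpen_interior
    have : Subsingleton (EuclideanSpace ℝ (Fin n)) := by
      by_contra hns
      rw [not_subsingleton_iff_nontrivial] at hns
      exact not_isOpen_singleton (0 : EuclideanSpace ℝ (Fin n)) hsing
    refine ⟨h.toAffineMap, h.injective.injOn, ?_⟩
    have hne : (h '' S).Nonempty := ⟨h p, mem_image_of_mem h hp.1⟩
    exact Subsingleton.set_cases (p := fun s => s.Nonempty → s = Metric.closedBall 0 1)
      (fun h => absurd h Set.not_nonempty_empty)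
      (fun _ => (eq_univ_of_forall fun x => by simp [Subsingleton.elim x 0]).symm) _ hne
  · have hTfront : frontier (h '' S) ⊆ Metric.sphere 0 ‖h p‖ := by
      rw [← hHh, ← H.image_frontier]
      rintro _ ⟨x, hx, rfl⟩
      exact mem_sphere_zero_iff_norm.2 (hext x (hfront hx))
    have hT := eq_closedBall_of_frontier_subset_sphere (hS.image hcont).isClosed hTint hr hsub
      hTfront
    have himage : (‖h p‖⁻¹ • h.toAffineMap) '' S = (fun y => ‖h p‖⁻¹ • y) '' (h '' S) := by
      rw [image_image]; rfl
    refine ⟨‖h p‖⁻¹ • h.toAffineMap, fun x _ y _ hxy => ?_, ?_⟩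
    · exact h.injective (smul_right_injective _ (inv_ne_zero hr) hxy)
    · rw [himage, hT, image_smul, smul_closedBall _ _ (norm_nonneg _), smul_zero, norm_inv,
        norm_norm, inv_mul_cancel₀ hr]

/-- Theorem: a compact convex set with full affine hull and vertex-transitive affine
automorphism group is affinely isomorphic to the closed unit ball iff every boundary point is an
extreme point. -/
theorem ball_iff_boundary_extreme {n : ℕ} (S : Set (EuclideanSpace ℝ (Fin n)))
    (hScompact : IsCompact S) (hSconvex : Convex ℝ S)
    (hspan : affineSpan ℝ S = ⊤)
    (htrans : AutTransitiveOnExtreme S) :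
    AffIso S (Metric.closedBall (0 : EuclideanSpace ℝ (Fin n)) 1) ↔
      frontier S ⊆ Set.extremePoints ℝ S := by
  have hint := hSconvex.interior_nonempty_iff_affineSpan_eq_top.2 hspan
  exact ⟨AffIso.frontier_subset_extremePoints hScompact.isClosed hint
      (strictConvex_closedBall ℝ _ _),
    affIso_closedBall_of_frontier_subset_extremePoints (by simp) hScompact hSconvex hint htrans⟩
end
end

section
/- Let S be a compact convex subset of ℝⁿ with affine hull ℝⁿ. Then S is affinely isomorphic to the closed unit ball of ℝⁿ if and only if: (1) the group G of bijective affine transformations of S acts transitively on the extreme points of S; (2) G acts transitively on ordered pairs of distinguishable extreme points; and (3) every point of S is a convex combination of at most 2 distinguishable extreme points. -/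
noncomputable section

/-- The points `s 0, …, s (k-1)` of the convex set `S` are distinguishable: there are affine
functionals `e i` that are nonnegative on `S`, sum to `1` on `S`, and satisfy `e i (s i) = 1`. -/
def Distinguishable {E : Type*} [NormedAddCommGroup E] [NormedSpace ℝ E]
    (S : Set E) {k : ℕ} (s : Fin k → E) : Prop :=
  ∃ e : Fin k → (E →ᵃ[ℝ] ℝ),
    (∀ i, ∀ x ∈ S, 0 ≤ e i x) ∧ (∀ x ∈ S, ∑ i, e i x = 1) ∧ (∀ i, e i (s i) = 1)

open MeasureTheory

open scoped MatrixOrder Matrix.Norms.L2Operator in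
theorem Matrix.PosDef.exists_isUnit_mul_transpose {ι : Type*} [Fintype ι] [DecidableEq ι]
    {M : Matrix ι ι ℝ} (hM : M.PosDef) : ∃ B : Matrix ι ι ℝ, IsUnit B ∧ M = B * B.transpose := by
  obtain ⟨B, hB, h⟩ := CStarAlgebra.isStrictlyPositive_iff_eq_mul_star_self.mp hM.isStrictlyPositive
  exact ⟨B, hB, by simpa [Matrix.star_eq_conjTranspose] using h⟩

theorem AffineEquiv.measurePreserving_restrict {E : Type*} [NormedAddCommGroup E]
    [NormedSpace ℝ E] [FiniteDimensional ℝ E] [MeasurableSpace E] [BorelSpace E]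
    (μ : Measure E) [μ.IsAddHaarMeasure] {S : Set E} (hS : IsCompact S)
    (hint : (interior S).Nonempty) (f : E ≃ᵃ[ℝ] E) (hf : f '' S = S) :
    MeasurePreserving f (μ.restrict S) (μ.restrict S) := by
  have hpre : f ⁻¹' S = S := by
    conv_lhs => rw [← hf]
    exact Set.preimage_image_eq _ f.injective
  have hcoe : (f : E → E) = (fun y => y + f 0) ∘ (f.linear : E →ₗ[ℝ] E) := by
    ext x
    have := f.map_vadd 0 x
    simpa using this
  have hdet : LinearMap.det (f.linear : E →ₗ[ℝ] E) ≠ 0 := f.linear.isUnit_det'.ne_zero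
  have hcont : Continuous f := f.toAffineMap.continuous_of_finiteDimensional
  have hlin : Continuous (f.linear : E →ₗ[ℝ] E) := LinearMap.continuous_of_finiteDimensional _
  have hmap : μ.map f = ENNReal.ofReal |(LinearMap.det (f.linear : E →ₗ[ℝ] E))⁻¹| • μ := by
    rw [hcoe, ← Measure.map_map (by fun_prop) hlin.measurable,
      Measure.map_linearMap_addHaar_eq_smul_addHaar μ hdet, Measure.map_smul,
      map_add_right_eq_self]
  have hpos : μ S ≠ 0 := (Measure.measure_pos_of_nonempty_interior μ hint).ne'
  have hone : ENNReal.ofReal |(LinearMap.det (f.linear : E →ₗ[ℝ] E))⁻¹| = 1 := by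
    have h := congrArg (fun ν => ν S) hmap
    simp only [Measure.map_apply hcont.measurable hS.measurableSet, hpre, Measure.smul_apply,
      smul_eq_mul] at h
    exact ((ENNReal.mul_eq_right hpos hS.measure_ne_top).mp h.symm)
  rw [hone, one_smul] at hmap
  have := (MeasurePreserving.mk hcont.measurable hmap).restrict_preimage hS.measurableSet
  rwa [hpre] at this

theorem Matrix.dotProduct_inv_mulVec_eq_of_conj_eq {ι : Type*} [Fintype ι] [DecidableEq ι]
    {A B : Matrix ι ι ℝ} (hB : IsUnit B)
    (hA : A * (B * B.transpose) * A.transpose = B * B.transpose) (y : ι → ℝ) :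
    B⁻¹.mulVec (A.mulVec y) ⬝ᵥ B⁻¹.mulVec (A.mulVec y) = B⁻¹.mulVec y ⬝ᵥ B⁻¹.mulVec y := by
  have hdet : IsUnit B.det := (Matrix.isUnit_iff_isUnit_det B).mp hB
  have hBB : B⁻¹ * B = 1 := Matrix.nonsing_inv_mul B hdet
  have hBT : B.transpose * B⁻¹.transpose = 1 := by
    rw [← Matrix.transpose_mul, hBB, Matrix.transpose_one]
  set U : Matrix ι ι ℝ := B⁻¹ * A * B with hU
  have hUU : U * U.transpose = 1 := by
    calc U * U.transpose
        = B⁻¹ * (A * (B * B.transpose) * A.transpose) * B⁻¹.transpose := by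
          simp only [hU, Matrix.transpose_mul, Matrix.mul_assoc]
      _ = (B⁻¹ * B) * (B.transpose * B⁻¹.transpose) := by
          rw [hA]; simp only [Matrix.mul_assoc]
      _ = 1 := by rw [hBB, hBT, one_mul]
  have hUU' : U.transpose * U = 1 := mul_eq_one_comm.mp hUU
  have hy : B⁻¹.mulVec (A.mulVec y) = U.mulVec (B⁻¹.mulVec y) := by
    simp only [Matrix.mulVec_mulVec, hU, Matrix.mul_assoc, Matrix.mul_nonsing_inv B hdet, mul_one]
  rw [hy, Matrix.dotProduct_mulVec, Matrix.vecMul_mulVec, hUU', Matrix.vecMul_one]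

section Covariance

variable {ι : Type*} [Fintype ι]

/-- The centroid of `S` with respect to Lebesgue measure. -/
def centroid (S : Set (EuclideanSpace ℝ ι)) : EuclideanSpace ℝ ι := ⨍ x in S, x

/-- The unnormalized covariance matrix of the Lebesgue measure restricted to `S`. -/
def covMatrix (S : Set (EuclideanSpace ℝ ι)) : Matrix ι ι ℝ :=
  Matrix.of fun i j => ∫ x in S, (x i - centroid S i) * (x j - centroid S j)

variable {S : Set (EuclideanSpace ℝ ι)}

theorem centroid_mem (hS : IsCompact S) (hconv : Convex ℝ S) (hint : (interior S).Nonempty) :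
    centroid S ∈ S :=
  hconv.set_average_mem hS.isClosed (Measure.measure_pos_of_nonempty_interior _ hint).ne'
    hS.measure_ne_top (ae_restrict_mem hS.measurableSet)
    (continuous_id.continuousOn.integrableOn_compact hS)

theorem map_centroid (hS : IsCompact S) (hint : (interior S).Nonempty)
    (f : EuclideanSpace ℝ ι ≃ᵃ[ℝ] EuclideanSpace ℝ ι) (hf : f '' S = S) :
    f (centroid S) = centroid S := by
  have hmp := f.measurePreserving_restrict volume hS hint hf
  have hpos : volume S ≠ 0 := (Measure.measure_pos_of_nonempty_interior _ hint).ne'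
  have hfin : volume S ≠ ⊤ := hS.measure_ne_top
  have hI : IntegrableOn (fun x : EuclideanSpace ℝ ι => x) S :=
    continuous_id.continuousOn.integrableOn_compact hS
  let L : EuclideanSpace ℝ ι →L[ℝ] EuclideanSpace ℝ ι :=
    LinearMap.toContinuousLinearMap (f.linear : EuclideanSpace ℝ ι →ₗ[ℝ] EuclideanSpace ℝ ι)
  have hcoe : ∀ x, f x = L x + f 0 := fun x => by
    simpa [L] using f.map_vadd 0 x
  have : NeZero (volume.restrict S) := ⟨by simpa using hpos⟩
  have : IsFiniteMeasure (volume.restrict S) := ⟨by simpa using hfin.lt_top⟩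
  have h1 : ⨍ x in S, f x = centroid S := by
    rw [centroid, average_eq, average_eq]
    congr 1
    exact hmp.integral_comp
      (AffineEquiv.toContinuousAffineEquiv f).toHomeomorph.measurableEmbedding fun x => x
  refine Eq.trans ?_ h1
  rw [hcoe, centroid, average_eq, average_eq, map_smul, ← L.integral_comp_comm hI]
  rw [integral_congr_ae (Filter.Eventually.of_forall hcoe),
    integral_add (L.integrable_comp hI) (integrable_const _), smul_add, integral_const, smul_smul,
    inv_mul_cancel₀, one_smul]
  simpa [Measure.real, ENNReal.toReal_eq_zero_iff] using ⟨hpos, hfin⟩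

theorem integrableOn_sub_mul_sub (hS : IsCompact S) (c : EuclideanSpace ℝ ι) (i j : ι) :
    IntegrableOn (fun x : EuclideanSpace ℝ ι => (x i - c i) * (x j - c j)) S :=
  ContinuousOn.integrableOn_compact hS (by fun_prop)

theorem posDef_covMatrix (hS : IsCompact S) (hint : (interior S).Nonempty) :
    (covMatrix S).PosDef := by
  have hI := integrableOn_sub_mul_sub hS (centroid S)
  refine Matrix.PosDef.of_dotProduct_mulVec_pos ?_ ?_
  · ext i j
    simp [covMatrix, mul_comm]
  intro v hv
  have hq : star v ⬝ᵥ (covMatrix S).mulVec v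
      = ∫ x in S, (∑ i, v i * (x i - centroid S i)) ^ 2 := by
    have : ∀ x : EuclideanSpace ℝ ι, (∑ i, v i * (x i - centroid S i)) ^ 2
        = ∑ i, ∑ j, v i * v j * ((x i - centroid S i) * (x j - centroid S j)) := fun x => by
      rw [sq, Finset.sum_mul_sum]
      exact Finset.sum_congr rfl fun i _ => Finset.sum_congr rfl fun j _ => by ring
    simp_rw [this]
    rw [integral_finsetSum _ fun i _ => integrable_finsetSum _ fun j _ => (hI i j).const_mul _]
    simp_rw [integral_finsetSum _ fun j _ => (hI _ j).const_mul _, integral_const_mul]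
    simp only [dotProduct, Matrix.mulVec, covMatrix, Matrix.of_apply, Finset.mul_sum, star_trivial]
    exact Finset.sum_congr rfl fun i _ => Finset.sum_congr rfl fun j _ => by ring
  rw [hq]
  refine lt_of_le_of_ne (integral_nonneg fun x => sq_nonneg _) fun h0 => hv ?_
  have hcont : Continuous fun x : EuclideanSpace ℝ ι => (∑ i, v i * (x i - centroid S i)) ^ 2 := by
    fun_prop
  have hae := (setIntegral_eq_zero_iff_of_nonneg_ae
    (Filter.Eventually.of_forall fun x => sq_nonneg _)
    (hcont.continuousOn.integrableOn_compact hS)).mp h0.symm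
  have heq := Measure.eqOn_open_of_ae_eq (ae_restrict_of_ae_restrict_of_subset interior_subset hae)
    isOpen_interior hcont.continuousOn continuousOn_const
  have hzero : ∀ x ∈ interior S, ∑ i, v i * (x i - centroid S i) = 0 := fun x hx => by
    simpa using heq hx
  obtain ⟨p, hp⟩ := hint
  have hnear : ∀ᶠ ε : ℝ in nhds 0, p + ε • WithLp.toLp 2 v ∈ interior S := by
    have : ContinuousAt (fun ε : ℝ => p + ε • WithLp.toLp 2 v) 0 := by fun_prop
    exact this.eventually (by simpa using isOpen_interior.mem_nhds hp)
  obtain ⟨ε, hε, hε0⟩ :=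
    ((hnear.filter_mono nhdsWithin_le_nhds).and (self_mem_nhdsWithin (s := {(0 : ℝ)}ᶜ))).exists
  have hsum : ε * ∑ i, v i * v i = 0 := by
    have h := hzero _ hε
    rw [← sub_eq_zero.mpr (h.trans (hzero p hp).symm), ← Finset.sum_sub_distrib, Finset.mul_sum]
    exact Finset.sum_congr rfl fun i _ => by simp; ring
  have : v ⬝ᵥ v = 0 := (mul_eq_zero.mp hsum).resolve_left hε0
  exact dotProduct_self_eq_zero.mp this

theorem conj_covMatrix [DecidableEq ι] (hS : IsCompact S) (hint : (interior S).Nonempty)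
    (f : EuclideanSpace ℝ ι ≃ᵃ[ℝ] EuclideanSpace ℝ ι) (hf : f '' S = S) :
    ∃ A : Matrix ι ι ℝ,
      (∀ x, (f x - centroid S).ofLp = A.mulVec (x - centroid S).ofLp) ∧
      A * covMatrix S * A.transpose = covMatrix S := by
  let A : Matrix ι ι ℝ := (Matrix.toLpLin 2 2).symm
    (f.linear : EuclideanSpace ℝ ι →ₗ[ℝ] EuclideanSpace ℝ ι)
  have hA : ∀ x, (f x - centroid S).ofLp = A.mulVec (x - centroid S).ofLp := fun x => by
    have h : f x - centroid S = f.linear (x - centroid S) := by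
      conv_lhs => rw [← map_centroid hS hint f hf]
      exact (f.toAffineMap.linearMap_vsub x (centroid S)).symm
    have h2 : Matrix.toLpLin 2 2 A (x - centroid S) = f.linear (x - centroid S) := by
      simp only [A, LinearEquiv.apply_symm_apply]; rfl
    rw [h, ← h2]; rfl
  refine ⟨A, hA, ?_⟩
  have hI := integrableOn_sub_mul_sub hS (centroid S)
  have hmp := f.measurePreserving_restrict volume hS hint hf
  ext i k
  have h1 : covMatrix S i k
      = ∫ x in S, (f x i - centroid S i) * (f x k - centroid S k) :=
    (hmp.integral_comp (AffineEquiv.toContinuousAffineEquiv f).toHomeomorph.measurableEmbedding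
      (fun x : EuclideanSpace ℝ ι => (x i - centroid S i) * (x k - centroid S k))).symm
  have h2 : ∀ x, (f x i - centroid S i) * (f x k - centroid S k)
      = ∑ j, ∑ l, A i j * A k l * ((x j - centroid S j) * (x l - centroid S l)) := fun x => by
    have hi := congrFun (hA x) i
    have hk := congrFun (hA x) k
    simp only [PiLp.sub_apply, Matrix.mulVec, dotProduct] at hi hk
    rw [hi, hk, Finset.sum_mul_sum]
    exact Finset.sum_congr rfl fun j _ => Finset.sum_congr rfl fun l _ => by ring
  rw [h1]
  simp_rw [h2]
  rw [integral_finsetSum _ fun i _ => integrable_finsetSum _ fun j _ => (hI i j).const_mul _]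
  simp_rw [integral_finsetSum _ fun j _ => (hI _ j).const_mul _, integral_const_mul]
  simp only [Matrix.mul_apply, Matrix.transpose_apply, covMatrix, Matrix.of_apply, Finset.sum_mul]
  rw [Finset.sum_comm]
  exact Finset.sum_congr rfl fun i _ => Finset.sum_congr rfl fun j _ => by ring

/-- The affine automorphisms of a convex body are isometries for a suitable Euclidean norm
centered at its centroid. -/
theorem exists_linearEquiv_norm_invariant (hS : IsCompact S) (hint : (interior S).Nonempty) :
    ∃ L : EuclideanSpace ℝ ι ≃ₗ[ℝ] EuclideanSpace ℝ ι,
      ∀ f : EuclideanSpace ℝ ι ≃ᵃ[ℝ] EuclideanSpace ℝ ι, f '' S = S →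
        ∀ x, ‖L (f x - centroid S)‖ = ‖L (x - centroid S)‖ := by
  classical
  obtain ⟨B, hB, hM⟩ := (posDef_covMatrix hS hint).exists_isUnit_mul_transpose
  have hdet : IsUnit B.det := (Matrix.isUnit_iff_isUnit_det B).mp hB
  let L : EuclideanSpace ℝ ι ≃ₗ[ℝ] EuclideanSpace ℝ ι :=
    (WithLp.linearEquiv 2 ℝ (ι → ℝ)).trans
      ((Matrix.toLin'OfInv (Matrix.nonsing_inv_mul B hdet)
        (Matrix.mul_nonsing_inv B hdet)).symm.trans
        (WithLp.linearEquiv 2 ℝ (ι → ℝ)).symm)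
  have hL : ∀ y, (L y).ofLp = B⁻¹.mulVec y.ofLp := fun y => rfl
  refine ⟨L, fun f hf x => ?_⟩
  obtain ⟨A, hA, hconj⟩ := conj_covMatrix hS hint f hf
  rw [hM] at hconj
  have h := Matrix.dotProduct_inv_mulVec_eq_of_conj_eq hB hconj (x - centroid S).ofLp
  rw [← hA, ← hL, ← hL] at h
  have hn : ∀ y : EuclideanSpace ℝ ι, ‖y‖ ^ 2 = y.ofLp ⬝ᵥ y.ofLp := fun y => by
    rw [EuclideanSpace.real_norm_sq_eq]
    simp [dotProduct, sq]
  rw [← hn, ← hn] at h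
  exact (sq_eq_sq₀ (norm_nonneg _) (norm_nonneg _)).mp h

end Covariance

theorem affIso_closedBall_of_segments {E : Type*} [NormedAddCommGroup E] [NormedSpace ℝ E]
    {S : Set E} (hconv : Convex ℝ S) (hint : (interior S).Nonempty) (c : E) (L : E ≃ₗ[ℝ] E)
    {r : ℝ} (hr : 0 < r)
    (hseg : ∀ x ∈ S, ∃ (v : E) (m : ℝ), c + v ∈ S ∧ c - v ∈ S ∧ ‖L v‖ = r ∧ |m| ≤ 1 ∧
      x = c + m • v) :
    ∃ f : E →ᵃ[ℝ] E, Set.InjOn f S ∧ f '' S = Metric.closedBall 0 1 := by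
  have hmem : ∀ (v : E) (m : ℝ), c + v ∈ S → c - v ∈ S → |m| ≤ 1 → c + m • v ∈ S := by
    intro v m h1 h2 hm
    obtain ⟨h3, h4⟩ := abs_le.mp hm
    have := hconv h1 h2 (a := (1 + m) / 2) (b := (1 - m) / 2) (by linarith) (by linarith) (by ring)
    convert this using 1
    module
  have hsymm : ∀ x ∈ S, c + (c - x) ∈ S := by
    intro x hx
    obtain ⟨v, m, h1, h2, -, hm, rfl⟩ := hseg x hx
    have := hmem v (-m) h1 h2 (by rwa [abs_neg])
    convert this using 1
    module
  have hnear : ∀ w : E, ∃ ε : ℝ, 0 < ε ∧ c + ε • w ∈ S := by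
    intro w
    obtain ⟨p, hp⟩ := hint
    have hev : ∀ᶠ ε : ℝ in nhds 0, p + (2 * ε) • w ∈ interior S := by
      have : ContinuousAt (fun ε : ℝ => p + (2 * ε) • w) 0 := by fun_prop
      exact this.eventually (by simpa using isOpen_interior.mem_nhds hp)
    obtain ⟨ε, hε, hε0⟩ :=
      ((hev.filter_mono nhdsWithin_le_nhds).and (self_mem_nhdsWithin (s := Set.Ioi (0 : ℝ)))).exists
    refine ⟨ε, hε0, ?_⟩
    have := hconv (interior_subset hε) (hsymm p (interior_subset hp)) (a := 1 / 2) (b := 1 / 2)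
      (by norm_num) (by norm_num) (by norm_num)
    convert this using 1
    module
  have hball : ∀ y, ‖L (y - c)‖ ≤ r → y ∈ S := by
    intro y hy
    obtain ⟨ε, hε, hε'⟩ := hnear (y - c)
    obtain ⟨v, m, h1, h2, hv, -, hx⟩ := hseg _ hε'
    have hw : y - c = (m / ε) • v := by
      have h : ε • (y - c) = m • v := add_left_cancel hx
      rw [div_eq_inv_mul, mul_smul, ← h, inv_smul_smul₀ hε.ne']
    rw [hw, map_smul, norm_smul, hv, Real.norm_eq_abs] at hy
    have := hmem v (m / ε) h1 h2 (le_of_mul_le_mul_right (by simpa using hy) hr)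
    rwa [← hw, add_sub_cancel] at this
  let f : E →ᵃ[ℝ] E :=
    (r⁻¹ • (L : E →ₗ[ℝ] E)).toAffineMap.comp (AffineMap.id ℝ E - AffineMap.const ℝ E c)
  have hf : ∀ x, f x = r⁻¹ • L (x - c) := fun x => rfl
  refine ⟨f, fun x _ y _ h => ?_, Set.Subset.antisymm ?_ fun y hy => ?_⟩
  · simp only [hf] at h
    simpa using L.injective (smul_right_injective E (inv_ne_zero hr.ne') h)
  · rintro _ ⟨x, hx, rfl⟩
    obtain ⟨v, m, -, -, hv, hm, rfl⟩ := hseg x hx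
    rw [mem_closedBall_zero_iff, hf, add_sub_cancel_left, map_smul, norm_smul, norm_smul, hv,
      norm_inv, Real.norm_of_nonneg hr.le, Real.norm_eq_abs]
    calc r⁻¹ * (|m| * r) = |m| := by field_simp
      _ ≤ 1 := hm
  · rw [mem_closedBall_zero_iff] at hy
    refine ⟨c + L.symm (r • y), hball _ ?_, ?_⟩
    · rw [add_sub_cancel_left, L.apply_symm_apply, norm_smul, Real.norm_of_nonneg hr.le]
      exact mul_le_of_le_one_right hr.le hy
    · rw [hf, add_sub_cancel_left, L.apply_symm_apply, inv_smul_smul₀ hr.ne']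

theorem affIso_closedBall_of_symmetric {E : Type*} [NormedAddCommGroup E] [NormedSpace ℝ E]
    [Nontrivial E] {S : Set E} (hconv : Convex ℝ S) (hint : (interior S).Nonempty)
    {c : E} (hc : c ∈ S) (L : E ≃ₗ[ℝ] E)
    (hL : ∀ f : E ≃ᵃ[ℝ] E, f '' S = S → ∀ x, ‖L (f x - c)‖ = ‖L (x - c)‖)
    (htrans : AutTransitiveOnExtreme S)
    (htrans₂ : ∀ s₁ s₂ t₁ t₂ : E,
      s₁ ∈ Set.extremePoints ℝ S → s₂ ∈ Set.extremePoints ℝ S →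
      t₁ ∈ Set.extremePoints ℝ S → t₂ ∈ Set.extremePoints ℝ S →
      Distinguishable S ![s₁, s₂] → Distinguishable S ![t₁, t₂] →
      ∃ f : E ≃ᵃ[ℝ] E, f '' S = S ∧ f s₁ = t₁ ∧ f s₂ = t₂)
    (hdec : ∀ x ∈ S, ∃ (k : ℕ) (s : Fin k → E) (l : Fin k → ℝ),
      0 < k ∧ k ≤ 2 ∧ (∀ j, s j ∈ Set.extremePoints ℝ S) ∧ Distinguishable S s ∧
      (∀ j, 0 ≤ l j) ∧ (∑ j, l j = 1) ∧ (∑ j, l j • s j = x)) :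
    AffIso S (Metric.closedBall (0 : E) 1) := by
  have hdec' : ∀ x ∈ S, x ∈ Set.extremePoints ℝ S ∨ ∃ s₁ ∈ Set.extremePoints ℝ S,
      ∃ s₂ ∈ Set.extremePoints ℝ S, ∃ a b : ℝ, Distinguishable S ![s₁, s₂] ∧ 0 ≤ a ∧ 0 ≤ b ∧
        a + b = 1 ∧ x = a • s₁ + b • s₂ := by
    intro x hx
    obtain ⟨k, s, l, hk, hk', hs, hd, hl, hl1, hsum⟩ := hdec x hx
    interval_cases k
    · left
      rw [Fin.sum_univ_one] at hl1 hsum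
      rw [← hsum, hl1, one_smul]
      exact hs 0
    · right
      rw [Fin.sum_univ_two] at hl1 hsum
      refine ⟨s 0, hs 0, s 1, hs 1, l 0, l 1, ?_, hl 0, hl 1, hl1, hsum.symm⟩
      convert hd using 1
      ext j
      fin_cases j <;> rfl
  have hfix : ∀ f : E ≃ᵃ[ℝ] E, f '' S = S → f c = c := fun f hf => by
    simpa [sub_eq_zero] using hL f hf c
  have hnorm : ∀ s ∈ Set.extremePoints ℝ S, ∀ t ∈ Set.extremePoints ℝ S,
      ‖L (s - c)‖ = ‖L (t - c)‖ := fun s hs t ht => by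
    obtain ⟨f, hf, rfl⟩ := htrans s hs t ht
    exact (hL f hf s).symm
  have hcext : c ∉ Set.extremePoints ℝ S := by
    intro hcext
    have heq : ∀ s ∈ Set.extremePoints ℝ S, s = c := fun s hs => by
      simpa [sub_eq_zero] using hnorm s hs c hcext
    have hsub : S ⊆ {c} := by
      intro x hx
      rcases hdec' x hx with h | ⟨s₁, h₁, s₂, h₂, a, b, -, -, -, hab, rfl⟩
      · exact heq x h
      · rw [heq s₁ h₁, heq s₂ h₂, ← add_smul, hab, one_smul]
        rfl
    have hemp := hint.mono (interior_mono hsub)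
    rw [interior_singleton] at hemp
    exact Set.not_nonempty_empty hemp
  obtain ⟨p, hp, q, hq, a, b, hpq, ha, hb, hab, hcab⟩ := (hdec' c hc).resolve_left hcext
  have hrpos : 0 < ‖L (p - c)‖ := by
    rw [norm_pos_iff, ne_eq, LinearEquiv.map_eq_zero_iff, sub_eq_zero]
    rintro rfl
    exact hcext hp
  have hzero : a • L (p - c) + b • L (q - c) = 0 := by
    rw [← map_smul, ← map_smul, ← map_add, LinearEquiv.map_eq_zero_iff]
    calc a • (p - c) + b • (q - c) = (a • p + b • q) - (a + b) • c := by module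
      _ = 0 := by rw [← hcab, hab, one_smul, sub_self]
  have habeq : a = b := by
    have h := congrArg norm (eq_neg_of_add_eq_zero_left hzero)
    rw [norm_neg, norm_smul, norm_smul, hnorm q hq p hp, Real.norm_of_nonneg ha,
      Real.norm_of_nonneg hb] at h
    exact mul_right_cancel₀ hrpos.ne' h
  have hmid : midpoint ℝ p q = c := by
    obtain rfl : a = 1 / 2 := by linarith
    rw [hcab, ← habeq, midpoint_eq_smul_add, smul_add]
    norm_num
  have hopp : ∀ f : E ≃ᵃ[ℝ] E, f '' S = S → f q = c - (f p - c) := fun f hf => by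
    have h := f.map_midpoint p q
    rw [hmid, hfix f hf, midpoint_eq_smul_add] at h
    have h2 : (2 : ℝ) • c = f p + f q := by
      rw [h, smul_smul]
      norm_num
    rw [two_smul] at h2
    rw [eq_sub_of_add_eq' h2.symm]
    abel
  refine affIso_closedBall_of_segments hconv hint c L hrpos fun x hx => ?_
  rcases hdec' x hx with h | ⟨s₁, h₁, s₂, h₂, a', b', hd, ha', hb', hab', rfl⟩
  · obtain ⟨f, hf, rfl⟩ := htrans p hp x h
    refine ⟨f p - c, 1, by simpa using hx, ?_, hL f hf p, by simp, by simp⟩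
    rw [← hopp f hf, ← hf]
    exact Set.mem_image_of_mem f hq.1
  · obtain ⟨f, hf, rfl, rfl⟩ := htrans₂ p q s₁ s₂ hp hq h₁ h₂ hpq hd
    refine ⟨f p - c, a' - b', by simpa using h₁.1, ?_, hL f hf p, ?_, ?_⟩
    · rw [← hopp f hf]
      exact h₂.1
    · rw [abs_le]
      constructor <;> linarith
    · rw [hopp f hf]
      obtain rfl : a' = 1 - b' := by linarith
      module

section Ball

variable {E : Type*} [NormedAddCommGroup E] [InnerProductSpace ℝ E]

theorem exists_linearIsometryEquiv_apply_eq [FiniteDimensional ℝ E] {x y : E} (h : ‖x‖ = ‖y‖) :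
    ∃ U : E ≃ₗᵢ[ℝ] E, U x = y :=
  ⟨Submodule.reflection (ℝ ∙ (x - y))ᗮ, Submodule.reflection_sub h⟩

theorem eq_neg_of_affine_separates_closedBall {x y : E} (hx : ‖x‖ = 1) (hy : ‖y‖ = 1)
    (e : E →ᵃ[ℝ] ℝ) (h0 : ∀ z, ‖z‖ ≤ 1 → 0 ≤ e z) (h1 : ∀ z, ‖z‖ ≤ 1 → e z ≤ 1)
    (hex : e x = 1) (hey : e y = 0) : y = -x := by
  have he : ∀ z, e z = e.linear z + e 0 := fun z => by
    simpa using e.map_vadd 0 z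
  have hx' := h0 (-x) (by rw [norm_neg, hx])
  have hy' := h1 (-y) (by rw [norm_neg, hy])
  rw [he, map_neg] at hx' hy'
  rw [he] at hex hey
  have hhalf : e 0 = 1 / 2 := by linarith
  have hlin : e.linear (x - y) = 1 := by
    rw [map_sub]
    linarith
  have hnorm : 2 ≤ ‖x - y‖ := by
    have hpos : 0 < ‖x - y‖ := by
      rw [norm_pos_iff]
      intro h
      simp [h] at hlin
    have h := h1 (‖x - y‖⁻¹ • (x - y)) (by
      rw [norm_smul, norm_inv, norm_norm, inv_mul_cancel₀ hpos.ne'])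
    rw [he, map_smul, hlin, hhalf, smul_eq_mul, mul_one] at h
    have h' : ‖x - y‖⁻¹ ≤ 1 / 2 := by linarith
    have := (inv_le_comm₀ hpos (by norm_num)).mp h'
    norm_num at this
    exact this
  have hpar := parallelogram_law_with_norm ℝ x y
  rw [hx, hy] at hpar
  have hsum : ‖x + y‖ = 0 := by nlinarith [norm_nonneg (x + y)]
  exact eq_neg_of_add_eq_zero_right (norm_eq_zero.mp hsum)

theorem exists_unit_smul_norm_eq [Nontrivial E] (y : E) : ∃ t : E, ‖t‖ = 1 ∧ y = ‖y‖ • t := by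
  obtain rfl | hy := eq_or_ne y 0
  · obtain ⟨t, ht⟩ := exists_norm_eq E zero_le_one
    exact ⟨t, ht, by simp⟩
  · refine ⟨‖y‖⁻¹ • y, ?_, ?_⟩
    · rw [norm_smul, norm_inv, norm_norm, inv_mul_cancel₀ (norm_ne_zero_iff.mpr hy)]
    · rw [smul_inv_smul₀ (norm_ne_zero_iff.mpr hy)]

end Ball

theorem AffineEquiv.mem_extremePoints_image_iff {E F : Type*} [AddCommGroup E] [Module ℝ E]
    [AddCommGroup F] [Module ℝ F] (f : E ≃ᵃ[ℝ] F) (S : Set E) (x : E) :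
    f x ∈ Set.extremePoints ℝ (f '' S) ↔ x ∈ Set.extremePoints ℝ S := by
  have h : ∀ y z, f '' openSegment ℝ y z = openSegment ℝ (f y) (f z) :=
    image_openSegment ℝ f.toAffineMap
  simp only [mem_extremePoints, f.surjective.forall, f.injective.mem_set_image, f.injective.eq_iff,
    ← h]

theorem symmetric_of_image_eq_closedBall {E : Type*} [NormedAddCommGroup E]
    [InnerProductSpace ℝ E] [FiniteDimensional ℝ E] [Nontrivial E] {S : Set E}
    (F : E ≃ᵃ[ℝ] E) (hF : F '' S = Metric.closedBall 0 1) :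
    AutTransitiveOnExtreme S ∧
      (∀ s₁ s₂ t₁ t₂ : E,
        s₁ ∈ Set.extremePoints ℝ S → s₂ ∈ Set.extremePoints ℝ S →
        t₁ ∈ Set.extremePoints ℝ S → t₂ ∈ Set.extremePoints ℝ S →
        Distinguishable S ![s₁, s₂] → Distinguishable S ![t₁, t₂] →
        ∃ f : E ≃ᵃ[ℝ] E, f '' S = S ∧ f s₁ = t₁ ∧ f s₂ = t₂) ∧
      (∀ x ∈ S, ∃ (k : ℕ) (s : Fin k → E) (l : Fin k → ℝ),
        0 < k ∧ k ≤ 2 ∧ (∀ j, s j ∈ Set.extremePoints ℝ S) ∧ Distinguishable S s ∧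
        (∀ j, 0 ≤ l j) ∧ (∑ j, l j = 1) ∧ (∑ j, l j • s j = x)) := by
  have hmem : ∀ x, x ∈ S ↔ ‖F x‖ ≤ 1 := fun x => by
    rw [← mem_closedBall_zero_iff, ← hF, F.injective.mem_set_image]
  have hext : ∀ x, x ∈ Set.extremePoints ℝ S ↔ ‖F x‖ = 1 := fun x => by
    rw [← F.mem_extremePoints_image_iff, hF, StrictConvexSpace.extremePoints_closedBall_eq_sphere,
      mem_sphere_zero_iff_norm]
  have hconj : ∀ U : E ≃ₗᵢ[ℝ] E, ∃ f : E ≃ᵃ[ℝ] E, f '' S = S ∧ ∀ x, f x = F.symm (U (F x)) := by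
    intro U
    let f : E ≃ᵃ[ℝ] E := (F.trans U.toLinearEquiv.toAffineEquiv).trans F.symm
    have hf : ∀ x, f x = F.symm (U (F x)) := fun x => rfl
    refine ⟨f, Set.Subset.antisymm ?_ fun y hy => ?_, hf⟩
    · rintro _ ⟨x, hx, rfl⟩
      rw [hmem] at hx ⊢
      rwa [hf, F.apply_symm_apply, U.norm_map]
    · rw [hmem] at hy
      refine ⟨F.symm (U.symm (F y)), ?_, ?_⟩
      · rwa [hmem, F.apply_symm_apply, U.symm.norm_map]
      · rw [hf, F.apply_symm_apply, U.apply_symm_apply, F.symm_apply_apply]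
  have hanti : ∀ x ∈ Set.extremePoints ℝ S, ∀ y ∈ Set.extremePoints ℝ S,
      Distinguishable S ![x, y] → F y = -F x := by
    rintro x hx y hy ⟨e, he0, he1, hes⟩
    rw [hext] at hx hy
    have hmem' : ∀ z, ‖z‖ ≤ 1 → F.symm z ∈ S := fun z hz => by
      rwa [hmem, F.apply_symm_apply]
    have hle : ∀ z ∈ S, e 0 z ≤ 1 := fun z hz => by
      have := he1 z hz
      rw [Fin.sum_univ_two] at this
      linarith [he0 1 z hz]
    have hy0 : e 0 y = 0 := by
      have h := he1 y ((hmem y).mpr hy.le)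
      have h1 : e 1 y = 1 := hes 1
      rw [Fin.sum_univ_two] at h
      linarith
    refine eq_neg_of_affine_separates_closedBall hx hy ((e 0).comp F.symm.toAffineMap)
      (fun z hz => he0 0 _ (hmem' z hz)) (fun z hz => hle _ (hmem' z hz)) ?_ ?_
    · simpa using hes 0
    · simpa using hy0
  refine ⟨fun x hx y hy => ?_, fun s₁ s₂ t₁ t₂ hs₁ hs₂ ht₁ ht₂ hs ht => ?_, fun x hx => ?_⟩
  · obtain ⟨U, hU⟩ := exists_linearIsometryEquiv_apply_eq
      (((hext x).mp hx).trans ((hext y).mp hy).symm)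
    obtain ⟨f, hf, hfx⟩ := hconj U
    exact ⟨f, hf, by rw [hfx, hU, F.symm_apply_apply]⟩
  · obtain ⟨U, hU⟩ := exists_linearIsometryEquiv_apply_eq
      (((hext s₁).mp hs₁).trans ((hext t₁).mp ht₁).symm)
    obtain ⟨f, hf, hfx⟩ := hconj U
    refine ⟨f, hf, by rw [hfx, hU, F.symm_apply_apply], ?_⟩
    rw [hfx, hanti s₁ hs₁ s₂ hs₂ hs, map_neg, hU, ← hanti t₁ ht₁ t₂ ht₂ ht, F.symm_apply_apply]
  · rw [hmem] at hx
    obtain ⟨t, ht, hxt⟩ := exists_unit_smul_norm_eq (F x)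
    let φ : E →ᵃ[ℝ] ℝ := (innerₛₗ ℝ t).toAffineMap.comp F.toAffineMap
    have hφ : ∀ z, φ z = inner ℝ t (F z) := fun z => rfl
    have hφle : ∀ z ∈ S, |φ z| ≤ 1 := fun z hz => by
      rw [hmem] at hz
      calc |φ z| ≤ ‖t‖ * ‖F z‖ := abs_real_inner_le_norm _ _
        _ ≤ 1 := by rwa [ht, one_mul]
    let c : E →ᵃ[ℝ] ℝ := AffineMap.const ℝ E (1 / 2)
    refine ⟨2, ![F.symm t, F.symm (-t)], ![(1 + ‖F x‖) / 2, (1 - ‖F x‖) / 2], by norm_num, le_rfl,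
      ?_, ⟨![c + (1 / 2 : ℝ) • φ, c - (1 / 2 : ℝ) • φ], ?_, ?_, ?_⟩, ?_, ?_, ?_⟩
    · simp [Fin.forall_fin_two, hext, ht]
    · simp only [Fin.forall_fin_two]
      constructor <;> intro z hz <;> have := abs_le.mp (hφle z hz) <;> simp [c] <;> linarith
    · intro z _
      simp [c, Fin.sum_univ_two]
      norm_num
    · simp [Fin.forall_fin_two, c, hφ, ht]
      norm_num
    · simp only [Fin.forall_fin_two]
      constructor <;> simp <;> linarith [norm_nonneg (F x)]
    · simp [Fin.sum_univ_two]
      ring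
    · have h := Convex.combo_affine_apply (f := F.symm.toAffineMap) (x := t) (y := -t)
        (a := (1 + ‖F x‖) / 2) (b := (1 - ‖F x‖) / 2) (by ring)
      have hx' : ((1 + ‖F x‖) / 2) • t + ((1 - ‖F x‖) / 2) • (-t) = F x := by
        conv_rhs => rw [hxt]
        module
      rw [hx'] at h
      simpa [Fin.sum_univ_two] using h.symm

theorem exists_affineEquiv_of_affIso {E : Type*} [NormedAddCommGroup E] [NormedSpace ℝ E]
    [FiniteDimensional ℝ E] {S T : Set E} (h : AffIso S T) (hT : affineSpan ℝ T = ⊤) :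
    ∃ F : E ≃ᵃ[ℝ] E, F '' S = T := by
  obtain ⟨f, -, hf⟩ := h
  have hsurj : Function.Surjective f := by
    have hle : (affineSpan ℝ S).map f ≤ (⊤ : AffineSubspace ℝ E).map f :=
      AffineSubspace.map_mono f le_top
    rw [AffineSubspace.map_span, hf, hT] at hle
    intro y
    obtain ⟨x, -, hx⟩ := hle (AffineSubspace.mem_top ℝ E y)
    exact ⟨x, hx⟩
  have hinj : Function.Injective f := by
    rw [← f.linear_injective_iff, LinearMap.injective_iff_surjective, f.linear_surjective_iff]
    exact hsurj
  exact ⟨AffineEquiv.ofBijective ⟨hinj, hsurj⟩, hf⟩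

/-- Theorem: a compact convex `S ⊆ ℝⁿ` with full affine hull is affinely isomorphic to the
closed unit ball iff (1) its affine automorphism group acts transitively on extreme points,
(2) it acts transitively on ordered pairs of distinguishable extreme points, and (3) `S` is
distinguishably 2-decomposable. -/
theorem characterization_finite_dim {n : ℕ} (S : Set (EuclideanSpace ℝ (Fin n)))
    (hScompact : IsCompact S) (hSconvex : Convex ℝ S)
    (hspan : affineSpan ℝ S = ⊤) :
    AffIso S (Metric.closedBall (0 : EuclideanSpace ℝ (Fin n)) 1) ↔
      (AutTransitiveOnExtreme S ∧
       (∀ s₁ s₂ t₁ t₂ : EuclideanSpace ℝ (Fin n),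
          s₁ ∈ Set.extremePoints ℝ S → s₂ ∈ Set.extremePoints ℝ S →
          t₁ ∈ Set.extremePoints ℝ S → t₂ ∈ Set.extremePoints ℝ S →
          Distinguishable S ![s₁, s₂] → Distinguishable S ![t₁, t₂] →
          ∃ f : EuclideanSpace ℝ (Fin n) ≃ᵃ[ℝ] EuclideanSpace ℝ (Fin n),
            f '' S = S ∧ f s₁ = t₁ ∧ f s₂ = t₂) ∧
       (∀ x ∈ S, ∃ (k : ℕ) (s : Fin k → EuclideanSpace ℝ (Fin n)) (l : Fin k → ℝ),
          0 < k ∧ k ≤ 2 ∧ (∀ j, s j ∈ Set.extremePoints ℝ S) ∧ Distinguishable S s ∧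
          (∀ j, 0 ≤ l j) ∧ (∑ j, l j = 1) ∧ (∑ j, l j • s j = x))) := by
  have hint : (interior S).Nonempty := hSconvex.interior_nonempty_iff_affineSpan_eq_top.mpr hspan
  obtain rfl | hn := Nat.eq_zero_or_pos n
  · have hS : S = {0} := by
      obtain ⟨x, hx⟩ := hint.mono interior_subset
      ext y
      simpa [Subsingleton.elim y x] using ⟨fun _ => Subsingleton.elim _ _, fun _ => hx⟩
    have hball : Metric.closedBall (0 : EuclideanSpace ℝ (Fin 0)) 1 = {0} := by
      ext y
      simp [Subsingleton.elim y 0]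
    refine ⟨fun _ => ⟨?_, ?_, ?_⟩, fun _ => ⟨AffineMap.id ℝ _, ?_, ?_⟩⟩
    · exact fun x _ y _ => ⟨AffineEquiv.refl ℝ _, by simp, Subsingleton.elim _ _⟩
    · exact fun _ _ _ _ _ _ _ _ _ _ =>
        ⟨AffineEquiv.refl ℝ _, by simp, Subsingleton.elim _ _, Subsingleton.elim _ _⟩
    · intro x _
      refine ⟨1, fun _ => 0, fun _ => 1, by simp, by simp, ?_, ?_, by simp, by simp,
        Subsingleton.elim _ _⟩
      · simp [hS]
      · exact ⟨fun _ => AffineMap.const ℝ _ 1, by simp, by simp, by simp⟩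
    · exact Set.injOn_of_injective Function.injective_id
    · rw [hS, hball]
      simp
  · have : Nonempty (Fin n) := ⟨⟨0, hn⟩⟩
    constructor
    · intro h
      have hT : affineSpan ℝ (Metric.closedBall (0 : EuclideanSpace ℝ (Fin n)) 1) = ⊤ := by
        rw [← (convex_closedBall _ _).interior_nonempty_iff_affineSpan_eq_top]
        exact ⟨0, Metric.ball_subset_interior_closedBall (Metric.mem_ball_self one_pos)⟩
      obtain ⟨F, hF⟩ := exists_affineEquiv_of_affIso h hT
      exact symmetric_of_image_eq_closedBall F hF
    · rintro ⟨h₁, h₂, h₃⟩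
      obtain ⟨L, hL⟩ := exists_linearEquiv_norm_invariant hScompact hint
      exact affIso_closedBall_of_symmetric hSconvex hint (centroid_mem hScompact hSconvex hint) L hL
        h₁ h₂ h₃
end
end
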